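/- For every n ≥ 1 and every m with 2 ≤ m (including m = ∞), in E = ℓ₁^m one has c_{ss+}(n, ℓ₁^m) = 2^{n−1}; in particular, sup{ ‖x^⊗n‖_{πs+} / ‖x‖₁ⁿ : 0 ≠ x ∈ ℝ² } = 2^{n−1} in ℓ₁². Moreover 2^{n−1} = γ(n), the smallest constant γ such that ‖x^⊗n‖_{πs+} ≤ γ·‖x‖₊ⁿ holds for all ordered normed spaces E and all x ∈ E. -/

import Mathlib

open scoped BigOperators TensorProduct
open PiTensorProduct

noncomputable section

/-- The projective tensor norm `‖·‖_π` on the `n`-th algebraic tensor power `E^⊗n`. -/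
def projNorm {E : Type*} [NormedAddCommGroup E] [NormedSpace ℝ E] (n : ℕ)
    (t : ⨂[ℝ] (_ : Fin n), E) : ℝ :=
  sInf {s : ℝ | ∃ (N : ℕ) (a : Fin N → ℝ) (x : Fin N → Fin n → E),
    t = ∑ k, a k • (⨂ₜ[ℝ] i, x k i) ∧ s = ∑ k, |a k| * ∏ i, ‖x k i‖}

/-- The positive projective tensor norm `‖·‖_{π+}` on `E^⊗n`: only decompositions into
elementary tensors of elements of the positive cone `P` are allowed. -/
def projNormPos {E : Type*} [NormedAddCommGroup E] [NormedSpace ℝ E] (P : Set E) (n : ℕ)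
    (t : ⨂[ℝ] (_ : Fin n), E) : ℝ :=
  sInf {s : ℝ | ∃ (N : ℕ) (a : Fin N → ℝ) (x : Fin N → Fin n → E),
    (∀ k i, x k i ∈ P) ∧ t = ∑ k, a k • (⨂ₜ[ℝ] i, x k i) ∧
    s = ∑ k, |a k| * ∏ i, ‖x k i‖}

/-- The symmetric projective tensor norm `‖·‖_{πs}` (decompositions into tensor powers). -/
def symProjNorm {E : Type*} [NormedAddCommGroup E] [NormedSpace ℝ E] (n : ℕ)
    (t : ⨂[ℝ] (_ : Fin n), E) : ℝ :=
  sInf {s : ℝ | ∃ (N : ℕ) (a : Fin N → ℝ) (x : Fin N → E),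
    t = ∑ k, a k • (⨂ₜ[ℝ] (_ : Fin n), x k) ∧ s = ∑ k, |a k| * ‖x k‖ ^ n}

/-- The positive symmetric projective tensor norm `‖·‖_{πs+}` (decompositions into tensor
powers of elements of the positive cone `P`). -/
def symProjNormPos {E : Type*} [NormedAddCommGroup E] [NormedSpace ℝ E] (P : Set E) (n : ℕ)
    (t : ⨂[ℝ] (_ : Fin n), E) : ℝ :=
  sInf {s : ℝ | ∃ (N : ℕ) (a : Fin N → ℝ) (x : Fin N → E),
    (∀ k, x k ∈ P) ∧ t = ∑ k, a k • (⨂ₜ[ℝ] (_ : Fin n), x k) ∧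
    s = ∑ k, |a k| * ‖x k‖ ^ n}

/-- `‖x‖₊ = inf{‖y‖+‖z‖ : x = y − z, y,z ∈ P}`. -/
def normPlus {E : Type*} [NormedAddCommGroup E] (P : Set E) (x : E) : ℝ :=
  sInf {r : ℝ | ∃ y ∈ P, ∃ z ∈ P, x = y - z ∧ r = ‖y‖ + ‖z‖}

/-- `c₊(E) = sup{‖x‖₊ : ‖x‖ ≤ 1}`. -/
def cPlus {E : Type*} [NormedAddCommGroup E] (P : Set E) : ℝ :=
  sSup {r : ℝ | ∃ x : E, ‖x‖ ≤ 1 ∧ r = normPlus P x}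

/-- `P` is a closed generating cone in `E`, i.e. `E` with `P` is an ordered normed space
with `E = P − P`. -/
def IsGenCone {E : Type*} [NormedAddCommGroup E] [NormedSpace ℝ E] (P : Set E) : Prop :=
  IsClosed P ∧ (∀ x ∈ P, ∀ y ∈ P, x + y ∈ P) ∧
    (∀ (c : ℝ), 0 ≤ c → ∀ x ∈ P, c • x ∈ P) ∧
    ∀ x : E, ∃ y ∈ P, ∃ z ∈ P, x = y - z

/-- `c₊(E)` is finite. -/
def CPlusFinite {E : Type*} [NormedAddCommGroup E] (P : Set E) : Prop :=
  BddAbove {r : ℝ | ∃ x : E, ‖x‖ ≤ 1 ∧ r = normPlus P x}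

/-- `c_{ss+}(n,E) = sup{‖x^⊗n‖_{πs+}/‖x‖ⁿ : 0 ≠ x ∈ E}`. -/
def cssPlus (E : Type*) [NormedAddCommGroup E] [NormedSpace ℝ E] (P : Set E) (n : ℕ) : ℝ :=
  sSup {r : ℝ | ∃ x : E, x ≠ 0 ∧
    r = symProjNormPos P n (⨂ₜ[ℝ] (_ : Fin n), x) / ‖x‖ ^ n}


open Polynomial in
lemma aux_T_le (n : ℕ) (v : ℝ) (hv : 1 ≤ v) :
    (Polynomial.Chebyshev.T ℝ ((n + 1 : ℕ) : ℤ)).eval v ≤ 2 ^ n * v ^ (n + 1) := by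
  induction n with
  | zero => simp
  | succ k ih =>
    have h := Polynomial.Chebyshev.T_add_two ℝ (k : ℤ)
    have h0 := Polynomial.Chebyshev.one_le_eval_T_real (k : ℤ) hv
    have e : (((k + 1 + 1 : ℕ)) : ℤ) = (k : ℤ) + 2 := by push_cast; ring
    rw [e, h]
    simp only [eval_sub, eval_mul, eval_X, eval_ofNat]
    push_cast at ih
    have h2 := mul_le_mul_of_nonneg_left ih (show (0 : ℝ) ≤ 2 * v by linarith)
    calc _ ≤ 2 * v * (2 ^ k * v ^ (k + 1)) := by linarith
      _ = _ := by ring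

open Polynomial Polynomial.Chebyshev in
lemma aux_interp (n : ℕ) (hn : 1 ≤ n) (v : ℝ) (hv : 1 < v) :
    ∃ c : ℕ → ℝ, (∀ p : ℝ[X], p.natDegree ≤ n →
      p.eval v = ∑ k ∈ Finset.range (n + 1), c k * p.eval (node n k)) ∧
      ∑ k ∈ Finset.range (n + 1), |c k| ≤ 2 ^ (n - 1) * v ^ n := by
  refine ⟨fun k => (Lagrange.basis (Finset.range (n + 1)) (node n) k).eval v, ?_, ?_⟩
  · intro p hp
    have hd : p.degree < (Finset.range (n + 1)).card := by
      rw [Finset.card_range]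
      refine lt_of_le_of_lt (Polynomial.degree_le_of_natDegree_le hp) ?_
      exact_mod_cast Nat.lt_succ_self n
    conv_lhs => rw [Lagrange.eq_interpolate (strictAntiOn_node n).injOn hd]
    rw [Lagrange.interpolate_apply, eval_finsetSum]
    refine Finset.sum_congr rfl fun k _ => ?_
    rw [eval_mul, eval_C, mul_comm]
  · have hT : (T ℝ n).eval v = ∑ k ∈ Finset.range (n + 1),
        (Lagrange.basis (Finset.range (n + 1)) (node n) k).eval v * (T ℝ n).eval (node n k) := by
      have hd : (T ℝ n).degree < (Finset.range (n + 1)).card := by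
        rw [Finset.card_range, degree_T]
        simp only [Int.natAbs_natCast]
        exact_mod_cast Nat.lt_succ_self n
      conv_lhs => rw [Lagrange.eq_interpolate (strictAntiOn_node n).injOn hd]
      rw [Lagrange.interpolate_apply, eval_finsetSum]
      refine Finset.sum_congr rfl fun k _ => ?_
      rw [eval_mul, eval_C, mul_comm]
    have key : ∑ k ∈ Finset.range (n + 1),
        |(Lagrange.basis (Finset.range (n + 1)) (node n) k).eval v| = (T ℝ n).eval v := by
      rw [hT]
      refine Finset.sum_congr rfl fun k hk => ?_
      have hk' : k ≤ n := Nat.lt_succ_iff.mp (Finset.mem_range.mp hk)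
      rw [eval_T_real_node (Finset.mem_Iic.mpr hk')]
      have hpos : 0 ≤ (Lagrange.basis (Finset.range (n + 1)) (node n) k).eval v * (-1) ^ k := by
        have h1 := zero_lt_prod_node_sub_node hk'
        have h2 : 0 < ∏ j ∈ (Finset.range (n + 1)).erase k, (v - node n j) := by
          refine Finset.prod_pos fun j _ => ?_
          have := (node_mem_Icc (n := n) (i := j)).2
          linarith
        have h3 : (Lagrange.basis (Finset.range (n + 1)) (node n) k).eval v =
            (∏ j ∈ (Finset.range (n + 1)).erase k, (node n k - node n j))⁻¹ *
            ∏ j ∈ (Finset.range (n + 1)).erase k, (v - node n j) := by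
          rw [Lagrange.basis, eval_prod, ← Finset.prod_inv_distrib, ← Finset.prod_mul_distrib]
          refine Finset.prod_congr rfl fun j _ => ?_
          simp [Lagrange.basisDivisor]
        have h4 := inv_pos_of_pos h1
        rw [mul_inv, ← inv_pow, inv_neg_one] at h4
        rw [h3]
        have := mul_pos h4 h2
        nlinarith
      rw [← abs_of_nonneg hpos, abs_mul]
      simp
    rw [key]
    obtain ⟨m, rfl⟩ : ∃ m, n = m + 1 := ⟨n - 1, by omega⟩
    simpa using aux_T_le m v hv.le

/-- values of positive decompositions -/
def decSet {E : Type*} [NormedAddCommGroup E] [NormedSpace ℝ E] (P : Set E) (n : ℕ)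
    (t : ⨂[ℝ] (_ : Fin n), E) : Set ℝ :=
  {s : ℝ | ∃ (N : ℕ) (a : Fin N → ℝ) (x : Fin N → E),
    (∀ k, x k ∈ P) ∧ t = ∑ k, a k • (⨂ₜ[ℝ] (_ : Fin n), x k) ∧
    s = ∑ k, |a k| * ‖x k‖ ^ n}

lemma symProjNormPos_eq {E : Type*} [NormedAddCommGroup E] [NormedSpace ℝ E] (P : Set E) (n : ℕ)
    (t : ⨂[ℝ] (_ : Fin n), E) : symProjNormPos P n t = sInf (decSet P n t) := rfl

lemma decSet_bddBelow {E : Type*} [NormedAddCommGroup E] [NormedSpace ℝ E] (P : Set E) (n : ℕ)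
    (t : ⨂[ℝ] (_ : Fin n), E) : BddBelow (decSet P n t) := by
  refine ⟨0, ?_⟩
  rintro s ⟨N, a, x, -, -, rfl⟩
  positivity

lemma aux_expand {E F : Type*} [AddCommGroup E] [Module ℝ E] [AddCommGroup F] [Module ℝ F] (n : ℕ)
    (f : MultilinearMap ℝ (fun _ : Fin n => E) F) (s t : ℝ) (e g : E) :
    f (fun _ => s • e + t • g) =
      ∑ S : Finset (Fin n), (s ^ S.card * t ^ (n - S.card)) •
        f (S.piecewise (fun _ => e) (fun _ => g)) := by
  have h := f.map_add_univ (fun _ => s • e) (fun _ => t • g)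
  have h' : ((fun _ => s • e) + (fun _ => t • g) : Fin n → E) = fun _ => s • e + t • g := rfl
  rw [h'] at h
  rw [h]
  refine Finset.sum_congr rfl fun S _ => ?_
  have : S.piecewise (fun _ => s • e) (fun _ => t • g) =
      fun i => (S.piecewise (fun _ => s) (fun _ => t) i : ℝ) •
        (S.piecewise (fun _ => e) (fun _ => g) i : E) := by
    funext i
    by_cases hi : i ∈ S <;> simp [hi]
  rw [this, f.map_smul_univ]
  congr 1
  have h2 := Finset.prod_piecewise Finset.univ S (fun _ : Fin n => s) (fun _ => t)
  rw [h2]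
  simp [Finset.card_sdiff]

open Polynomial Polynomial.Chebyshev in
lemma aux_dec {E : Type*} [NormedAddCommGroup E] [NormedSpace ℝ E] (P : Set E) (n : ℕ)
    (hn : 1 ≤ n) (hP : IsGenCone P) (e f : E) (he : e ∈ P) (hf : f ∈ P) (he1 : ‖e‖ ≤ 1)
    (hf1 : ‖f‖ ≤ 1) (a b : ℝ) (hb : 0 < b) (hab : b < a) :
    ∃ s ∈ decSet P n (⨂ₜ[ℝ] (_ : Fin n), (a • e - b • f)), s ≤ 2 ^ (n - 1) * (a + b) ^ n := by
  obtain ⟨-, hadd, hsmul, -⟩ := hP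
  set σ := a - b with hσ
  have hσ0 : 0 < σ := by linarith
  set v := (a + b) / σ with hv
  have hv1 : 1 < v := by rw [hv, lt_div_iff₀ hσ0]; linarith
  have hσv : σ * v = a + b := by rw [hv]; field_simp
  obtain ⟨c, hc, hcs⟩ := aux_interp n hn v hv1
  have hu := fun k : ℕ => (node_mem_Icc (n := n) (i := k))
  refine ⟨_, ⟨n + 1, fun k => σ ^ n * c k,
    fun k => ((1 + node n k) / 2) • e + ((1 - node n k) / 2) • f, ?_, ?_, rfl⟩, ?_⟩
  · intro k
    have := hu k
    exact hadd _ (hsmul _ (by linarith [this.1]) _ he) _ (hsmul _ (by linarith [this.2]) _ hf)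
  · have e1 : a • e - b • f = (σ * ((1 + v) / 2)) • e + (σ * ((1 - v) / 2)) • f := by
      have h1 : σ * ((1 + v) / 2) = a := by linarith
      have h2 : σ * ((1 - v) / 2) = -b := by linarith
      rw [h1, h2, neg_smul, sub_eq_add_neg]
    rw [e1]
    simp only [aux_expand n (PiTensorProduct.tprod ℝ)]
    simp only [Finset.smul_sum]
    rw [Finset.sum_comm]
    refine Finset.sum_congr rfl fun S _ => ?_
    simp only [smul_smul]
    rw [← Finset.sum_smul]
    congr 1
    have hS : S.card ≤ n := by simpa using S.card_le_univ
    have h := hc ((C (1 / 2) * (1 + X)) ^ S.card * (C (1 / 2) * (1 - X)) ^ (n - S.card)) (by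
      have h1 : (C (1 / 2 : ℝ) * (1 + X)).natDegree ≤ 1 := by compute_degree
      have h2 : (C (1 / 2 : ℝ) * (1 - X)).natDegree ≤ 1 := by compute_degree
      refine (natDegree_mul_le).trans ?_
      have h3 := natDegree_pow_le_of_le S.card h1
      have h4 := natDegree_pow_le_of_le (n - S.card) h2
      omega)
    simp only [eval_mul, eval_pow, eval_C, eval_add, eval_sub, eval_one, eval_X] at h
    rw [Finset.sum_range] at h
    have hs : σ ^ n = σ ^ S.card * σ ^ (n - S.card) := by rw [← pow_add]; congr 1; omega
    calc _ = σ ^ n * ((1 / 2 * (1 + v)) ^ S.card * (1 / 2 * (1 - v)) ^ (n - S.card)) := by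
          rw [hs, mul_pow, mul_pow]; ring
      _ = _ := by
          rw [h, Finset.mul_sum]
          refine Finset.sum_congr rfl fun k _ => ?_
          ring
  · calc _ ≤ ∑ k : Fin (n + 1), σ ^ n * |c k| := by
          refine Finset.sum_le_sum fun k _ => ?_
          rw [abs_mul, abs_of_pos (pow_pos hσ0 n)]
          refine mul_le_of_le_one_right (by positivity) (pow_le_one₀ (norm_nonneg _) ?_)
          have := hu k
          have h1 : 0 ≤ (1 + node n k) / 2 := by linarith [this.1]
          have h2 : 0 ≤ (1 - node n k) / 2 := by linarith [this.2]
          refine (norm_add_le _ _).trans ?_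
          rw [norm_smul, norm_smul, Real.norm_of_nonneg h1, Real.norm_of_nonneg h2]
          nlinarith
      _ = σ ^ n * ∑ k ∈ Finset.range (n + 1), |c k| := by
          rw [← Finset.mul_sum, Finset.sum_range]
      _ ≤ σ ^ n * (2 ^ (n - 1) * v ^ n) := by gcongr
      _ = 2 ^ (n - 1) * (σ * v) ^ n := by rw [mul_pow]; ring
      _ = _ := by rw [hσv]

lemma aux_dec_neg {E : Type*} [NormedAddCommGroup E] [NormedSpace ℝ E] (P : Set E) (n : ℕ)
    (x : E) (s : ℝ) (hs : s ∈ decSet P n (⨂ₜ[ℝ] (_ : Fin n), x)) :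
    s ∈ decSet P n (⨂ₜ[ℝ] (_ : Fin n), (-x)) := by
  obtain ⟨N, a, y, h1, h2, h3⟩ := hs
  refine ⟨N, fun k => (-1) ^ n * a k, y, h1, ?_, ?_⟩
  · have := (PiTensorProduct.tprod ℝ).map_smul_univ (fun _ : Fin n => (-1 : ℝ)) (fun _ => x)
    simp only [neg_smul, one_smul, Finset.prod_const, Finset.card_univ, Fintype.card_fin] at this
    rw [this, h2, Finset.smul_sum]
    simp only [smul_smul]
  · rw [h3]; simp [abs_mul]

lemma aux_dec2 {E : Type*} [NormedAddCommGroup E] [NormedSpace ℝ E] (P : Set E) (n : ℕ)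
    (hn : 1 ≤ n) (hP : IsGenCone P) (y z : E) (hy : y ∈ P) (hz : z ∈ P) (r : ℝ)
    (hr : ‖y‖ + ‖z‖ < r) :
    ∃ s ∈ decSet P n (⨂ₜ[ℝ] (_ : Fin n), (y - z)), s ≤ 2 ^ (n - 1) * r ^ n := by
  have main : ∀ (y z : E) (hy : y ∈ P) (hz : z ∈ P), ‖z‖ ≤ ‖y‖ → ‖y‖ + ‖z‖ < r →
      ∃ s ∈ decSet P n (⨂ₜ[ℝ] (_ : Fin n), (y - z)), s ≤ 2 ^ (n - 1) * r ^ n := by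
    intro y z hy hz hle hr
    set δ := r - (‖y‖ + ‖z‖) with hδ
    have hδ0 : 0 < δ := by linarith
    have hb : 0 < ‖z‖ + δ / 4 := by positivity
    have ha : 0 < ‖y‖ + 3 * δ / 4 := by positivity
    have h := aux_dec P n hn hP ((‖y‖ + 3 * δ / 4)⁻¹ • y) ((‖z‖ + δ / 4)⁻¹ • z)
      (hP.2.2.1 _ (by positivity) _ hy) (hP.2.2.1 _ (by positivity) _ hz)
      (by rw [norm_smul, Real.norm_of_nonneg (by positivity), inv_mul_le_one₀ ha]; linarith)
      (by rw [norm_smul, Real.norm_of_nonneg (by positivity), inv_mul_le_one₀ hb]; linarith)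
      (‖y‖ + 3 * δ / 4) (‖z‖ + δ / 4) hb (by linarith)
    rw [smul_inv_smul₀ ha.ne', smul_inv_smul₀ hb.ne'] at h
    have hsum : ‖y‖ + 3 * δ / 4 + (‖z‖ + δ / 4) = r := by rw [hδ]; ring
    rwa [hsum] at h
  rcases le_total ‖z‖ ‖y‖ with h | h
  · exact main y z hy hz h hr
  · obtain ⟨s, hs, hs'⟩ := main z y hz hy h (by linarith)
    refine ⟨s, ?_, hs'⟩
    have := aux_dec_neg P n _ s hs
    rwa [neg_sub] at this

lemma normPlus_nonneg {E : Type*} [NormedAddCommGroup E] (P : Set E) (x : E) :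
    0 ≤ normPlus P x := by
  refine Real.sInf_nonneg ?_
  rintro r ⟨y, -, z, -, -, rfl⟩
  positivity

lemma aux_upper {E : Type*} [NormedAddCommGroup E] [NormedSpace ℝ E] (P : Set E) (n : ℕ)
    (hn : 1 ≤ n) (hP : IsGenCone P) (x : E) :
    symProjNormPos P n (⨂ₜ[ℝ] (_ : Fin n), x) ≤ 2 ^ (n - 1) * normPlus P x ^ n := by
  have h : ∀ r, normPlus P x < r →
      symProjNormPos P n (⨂ₜ[ℝ] (_ : Fin n), x) ≤ 2 ^ (n - 1) * r ^ n := by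
    intro r hr
    have hne : {r : ℝ | ∃ y ∈ P, ∃ z ∈ P, x = y - z ∧ r = ‖y‖ + ‖z‖}.Nonempty := by
      obtain ⟨y, hy, z, hz, hx⟩ := hP.2.2.2 x
      exact ⟨_, y, hy, z, hz, hx, rfl⟩
    obtain ⟨q, ⟨y, hy, z, hz, hx, rfl⟩, hq⟩ := exists_lt_of_csInf_lt hne hr
    obtain ⟨s, hs, hs'⟩ := aux_dec2 P n hn hP y z hy hz r hq
    rw [← hx] at hs
    exact (csInf_le (decSet_bddBelow P n _) hs).trans hs'
  have ht : Filter.Tendsto (fun r : ℝ => 2 ^ (n - 1) * r ^ n)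
      (nhdsWithin (normPlus P x) (Set.Ioi (normPlus P x)))
      (nhds (2 ^ (n - 1) * normPlus P x ^ n)) := by
    refine Filter.Tendsto.mono_left ?_ nhdsWithin_le_nhds
    exact Continuous.tendsto (by fun_prop) _
  refine ge_of_tendsto ht ?_
  filter_upwards [self_mem_nhdsWithin] with r hr using h r hr

lemma decSet_nonempty {E : Type*} [NormedAddCommGroup E] [NormedSpace ℝ E] (P : Set E) (n : ℕ)
    (hn : 1 ≤ n) (hP : IsGenCone P) (x : E) :
    (decSet P n (⨂ₜ[ℝ] (_ : Fin n), x)).Nonempty := by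
  obtain ⟨y, hy, z, hz, rfl⟩ := hP.2.2.2 x
  obtain ⟨s, hs, -⟩ := aux_dec2 P n hn hP y z hy hz _ (lt_add_one _)
  exact ⟨s, hs⟩

open Polynomial Polynomial.Chebyshev in
lemma aux_lower {E : Type*} [NormedAddCommGroup E] [NormedSpace ℝ E] (P : Set E) (n : ℕ)
    (hn : 1 ≤ n) (hP : IsGenCone P) (u w : E →ₗ[ℝ] ℝ)
    (h : ∀ x ∈ P, |u x| ≤ w x ∧ w x ≤ ‖x‖) (x : E) (hu : u x = 1) (hw : w x = 0) :
    2 ^ (n - 1) ≤ symProjNormPos P n (⨂ₜ[ℝ] (_ : Fin n), x) := by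
  let Φ : MultilinearMap ℝ (fun _ : Fin n => E) ℝ :=
    ∑ j ∈ Finset.range (n + 1), (T ℝ n).coeff j •
      (MultilinearMap.mkPiAlgebra ℝ (Fin n) ℝ).compLinearMap
        (fun i => if i.val < j then u else w)
  have hΦ : ∀ y : E, Φ (fun _ => y) =
      ∑ j ∈ Finset.range (n + 1), (T ℝ n).coeff j * (u y ^ j * w y ^ (n - j)) := by
    intro y
    simp only [Φ, MultilinearMap.sum_apply, MultilinearMap.smul_apply,
      MultilinearMap.compLinearMap_apply, MultilinearMap.mkPiAlgebra_apply, smul_eq_mul]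
    refine Finset.sum_congr rfl fun j hj => ?_
    congr 1
    have hj' : j ≤ n := Nat.lt_succ_iff.mp (Finset.mem_range.mp hj)
    have : ∀ i : Fin n, (if i.val < j then u else w) y = if i.val < j then u y else w y := by
      intro i; split_ifs <;> rfl
    simp only [this]
    rw [Finset.prod_fin_eq_prod_range, ]
    have : ∀ i ∈ Finset.range n, (if h : i < n then (if i < j then u y else w y) else 1) =
      (if i < j then u y else w y) := by
      intro i hi; rw [dif_pos (Finset.mem_range.mp hi)]
    rw [Finset.prod_congr rfl this, ← Finset.prod_range_mul_prod_Ico _ hj']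
    rw [Finset.prod_congr rfl (g := fun _ => u y) (fun i hi => if_pos (Finset.mem_range.mp hi)),
      Finset.prod_congr (s₁ := Finset.Ico j n) rfl (g := fun _ => w y)
        (fun i hi => if_neg (not_lt.mpr (Finset.mem_Ico.mp hi).1))]
    simp
  have hdeg : (T ℝ n).natDegree = n := by simp
  have hbd : ∀ y ∈ P, |Φ (fun _ => y)| ≤ ‖y‖ ^ n := by
    intro y hy
    obtain ⟨h1, h2⟩ := h y hy
    have hw0 : 0 ≤ w y := (abs_nonneg _).trans h1
    rw [hΦ]
    rcases hw0.eq_or_lt with h0 | h0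
    · have hu0 : u y = 0 := by
        rw [← h0] at h1; exact abs_nonpos_iff.mp h1
      rw [hu0, ← h0, Finset.sum_eq_zero]
      · simp
      · intro j hj
        rw [← pow_add, zero_pow, mul_zero]
        have := Finset.mem_range.mp hj
        omega
    · have : ∑ j ∈ Finset.range (n + 1), (T ℝ n).coeff j * (u y ^ j * w y ^ (n - j)) =
          w y ^ n * (T ℝ n).eval (u y / w y) := by
        rw [eval_eq_sum_range, hdeg, Finset.mul_sum]
        refine Finset.sum_congr rfl fun j hj => ?_
        have hj' : j ≤ n := Nat.lt_succ_iff.mp (Finset.mem_range.mp hj)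
        rw [div_pow, ← pow_sub_mul_pow (w y) hj']
        field_simp
      rw [this, abs_mul, abs_of_pos (pow_pos h0 n)]
      have h3 : |(T ℝ n).eval (u y / w y)| ≤ 1 := by
        apply abs_eval_T_real_le_one
        rw [abs_div, abs_of_pos h0, div_le_one h0]
        exact h1
      calc _ ≤ w y ^ n := mul_le_of_le_one_right (by positivity) h3
        _ ≤ _ := by gcongr
  have hx : Φ (fun _ => x) = 2 ^ (n - 1) := by
    rw [hΦ, Finset.sum_range_succ, Finset.sum_eq_zero]
    · have : (T ℝ n).coeff n = (T ℝ n).leadingCoeff := by rw [leadingCoeff, hdeg]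
      rw [this, leadingCoeff_T, hu]
      simp
    · intro j hj
      rw [hw, zero_pow, mul_zero, mul_zero]
      have := Finset.mem_range.mp hj
      omega
  rw [symProjNormPos_eq]
  refine le_csInf (decSet_nonempty P n hn hP x) ?_
  rintro s ⟨N, a, y, hy, hxy, rfl⟩
  have h1 := congrArg (PiTensorProduct.lift Φ) hxy
  rw [PiTensorProduct.lift.tprod, hx, map_sum] at h1
  simp only [map_smul, PiTensorProduct.lift.tprod, smul_eq_mul] at h1
  rw [h1]
  refine Finset.sum_le_sum fun k _ => ?_
  calc _ ≤ |a k * Φ fun _ => y k| := le_abs_self _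
    _ = |a k| * |Φ fun _ => y k| := abs_mul _ _
    _ ≤ _ := by gcongr; exact hbd _ (hy k)

lemma normPlus_le_of {E : Type*} [NormedAddCommGroup E] [NormedSpace ℝ E] (P : Set E) (x : E)
    (hd : ∃ y ∈ P, ∃ z ∈ P, x = y - z ∧ ‖y‖ + ‖z‖ ≤ ‖x‖) : normPlus P x ≤ ‖x‖ := by
  obtain ⟨y, hy, z, hz, hx, hn⟩ := hd
  refine le_trans (csInf_le ⟨0, ?_⟩ ⟨y, hy, z, hz, hx, rfl⟩) hn
  rintro r ⟨y, -, z, -, -, rfl⟩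
  positivity

lemma aux_css {E : Type*} [NormedAddCommGroup E] [NormedSpace ℝ E] (P : Set E) (n : ℕ)
    (hn : 1 ≤ n) (hP : IsGenCone P)
    (hd : ∀ x : E, ∃ y ∈ P, ∃ z ∈ P, x = y - z ∧ ‖y‖ + ‖z‖ ≤ ‖x‖)
    (u w : E →ₗ[ℝ] ℝ)
    (h : ∀ x ∈ P, |u x| ≤ w x ∧ w x ≤ ‖x‖) (x : E) (hu : u x = 1) (hw : w x = 0)
    (hx : ‖x‖ = 1) : cssPlus E P n = 2 ^ (n - 1) := by
  have hx0 : x ≠ 0 := by rintro rfl; simp at hx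
  have hub : ∀ r ∈ {r : ℝ | ∃ x : E, x ≠ 0 ∧
      r = symProjNormPos P n (⨂ₜ[ℝ] (_ : Fin n), x) / ‖x‖ ^ n}, r ≤ 2 ^ (n - 1) := by
    rintro r ⟨y, hy, rfl⟩
    have : 0 < ‖y‖ := norm_pos_iff.mpr hy
    rw [div_le_iff₀ (by positivity)]
    refine (aux_upper P n hn hP y).trans ?_
    have h1 := normPlus_nonneg P y
    have h2 := normPlus_le_of P y (hd y)
    gcongr
  refine le_antisymm (csSup_le ⟨_, x, hx0, rfl⟩ hub) ?_
  refine le_csSup_of_le ⟨_, hub⟩ ⟨x, hx0, rfl⟩ ?_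
  rw [hx]
  simpa using aux_lower P n hn hP u w h x hu hw

lemma PiLp_cone {ι : Type*} [Fintype ι] :
    IsGenCone {x : PiLp 1 fun _ : ι => ℝ | ∀ i, 0 ≤ x i} ∧
    ∀ x : PiLp 1 fun _ : ι => ℝ, ∃ y ∈ {x : PiLp 1 fun _ : ι => ℝ | ∀ i, 0 ≤ x i},
      ∃ z ∈ {x : PiLp 1 fun _ : ι => ℝ | ∀ i, 0 ≤ x i}, x = y - z ∧ ‖y‖ + ‖z‖ ≤ ‖x‖ := by
  have hd : ∀ x : PiLp 1 fun _ : ι => ℝ, ∃ y ∈ {x : PiLp 1 fun _ : ι => ℝ | ∀ i, 0 ≤ x i},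
      ∃ z ∈ {x : PiLp 1 fun _ : ι => ℝ | ∀ i, 0 ≤ x i}, x = y - z ∧ ‖y‖ + ‖z‖ ≤ ‖x‖ := by
    intro x
    refine ⟨WithLp.toLp 1 fun i => max (x i) 0, fun i => le_max_right _ _,
      WithLp.toLp 1 fun i => max (-x i) 0, fun i => le_max_right _ _, ?_, ?_⟩
    · ext i
      simp only [PiLp.sub_apply]
      rcases le_total (x i) 0 with h | h
      · rw [max_eq_right h, max_eq_left (by linarith)]; ring
      · rw [max_eq_left h, max_eq_right (by linarith)]; ring
    · rw [PiLp.norm_eq_of_L1, PiLp.norm_eq_of_L1, PiLp.norm_eq_of_L1, ← Finset.sum_add_distrib]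
      refine Finset.sum_le_sum fun i _ => ?_
      simp only [Real.norm_eq_abs]
      rcases le_total (x i) 0 with h | h
      · rw [max_eq_right h, max_eq_left (by linarith)]; simp
      · rw [max_eq_left h, max_eq_right (by linarith)]; simp
  refine ⟨⟨?_, ?_, ?_, ?_⟩, hd⟩
  · rw [Set.setOf_forall]
    refine isClosed_iInter fun i => ?_
    exact isClosed_le continuous_const (by fun_prop)
  · intro x hx y hy i
    exact add_nonneg (hx i) (hy i)
  · intro c hc x hx i
    exact mul_nonneg hc (hx i)
  · intro x
    obtain ⟨y, hy, z, hz, h, -⟩ := hd x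
    exact ⟨y, hy, z, hz, h⟩

lemma lp_summ (x : lp (fun _ : ℕ => ℝ) 1) : Summable fun i => |x i| := by
  have := (lp.memℓp x).summable (by simp)
  simpa using this

lemma lp_norm1 (x : lp (fun _ : ℕ => ℝ) 1) : ‖x‖ = ∑' i, |x i| := by
  have := lp.norm_eq_tsum_rpow (p := 1) (by simp) x
  simpa using this

lemma lp_mem1 (f : ℕ → ℝ) (h : Summable fun i => |f i|) : Memℓp f 1 := by
  apply memℓp_gen
  simpa using h

lemma lp_cone :
    IsGenCone {x : lp (fun _ : ℕ => ℝ) 1 | ∀ i, 0 ≤ x i} ∧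
    ∀ x : lp (fun _ : ℕ => ℝ) 1, ∃ y ∈ {x : lp (fun _ : ℕ => ℝ) 1 | ∀ i, 0 ≤ x i},
      ∃ z ∈ {x : lp (fun _ : ℕ => ℝ) 1 | ∀ i, 0 ≤ x i}, x = y - z ∧ ‖y‖ + ‖z‖ ≤ ‖x‖ := by
  have hd : ∀ x : lp (fun _ : ℕ => ℝ) 1, ∃ y ∈ {x : lp (fun _ : ℕ => ℝ) 1 | ∀ i, 0 ≤ x i},
      ∃ z ∈ {x : lp (fun _ : ℕ => ℝ) 1 | ∀ i, 0 ≤ x i}, x = y - z ∧ ‖y‖ + ‖z‖ ≤ ‖x‖ := by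
    intro x
    have hs := lp_summ x
    have s1 : Summable fun i => |max (x i) 0| := by
      refine Summable.of_nonneg_of_le (fun i => abs_nonneg _) (fun i => ?_) hs
      rw [abs_of_nonneg (le_max_right _ _)]
      exact max_le (le_abs_self _) (abs_nonneg _)
    have s2 : Summable fun i => |max (-x i) 0| := by
      refine Summable.of_nonneg_of_le (fun i => abs_nonneg _) (fun i => ?_) hs
      rw [abs_of_nonneg (le_max_right _ _)]
      exact max_le (neg_le_abs _) (abs_nonneg _)
    refine ⟨⟨fun i => max (x i) 0, lp_mem1 _ s1⟩, fun i => le_max_right _ _,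
      ⟨fun i => max (-x i) 0, lp_mem1 _ s2⟩, fun i => le_max_right _ _, ?_, ?_⟩
    · ext i
      rw [lp.coeFn_sub]
      change x i = max (x i) 0 - max (-x i) 0
      rcases le_total (x i) 0 with h | h
      · rw [max_eq_right h, max_eq_left (by linarith)]; ring
      · rw [max_eq_left h, max_eq_right (by linarith)]; ring
    · rw [lp_norm1, lp_norm1, lp_norm1]
      change ∑' i, |max (x i) 0| + ∑' i, |max (-x i) 0| ≤ _
      rw [← s1.tsum_add s2]
      refine (s1.add s2).tsum_le_tsum (fun i => ?_) hs
      rcases le_total (x i) 0 with h | h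
      · rw [max_eq_right h, max_eq_left (by linarith)]; simp
      · rw [max_eq_left h, max_eq_right (by linarith)]; simp
  refine ⟨⟨?_, ?_, ?_, ?_⟩, hd⟩
  · rw [Set.setOf_forall]
    refine isClosed_iInter fun i => ?_
    refine isClosed_le continuous_const ?_
    exact (lp.evalCLM ℝ (fun _ : ℕ => ℝ) 1 i).continuous
  · intro x hx y hy i
    exact add_nonneg (hx i) (hy i)
  · intro c hc x hx i
    exact mul_nonneg hc (hx i)
  · intro x
    obtain ⟨y, hy, z, hz, h, -⟩ := hd x
    exact ⟨y, hy, z, hz, h⟩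

lemma PiLp_funs {ι : Type*} [Fintype ι] (i j : ι) (hij : i ≠ j) :
    ∃ (u w : (PiLp 1 fun _ : ι => ℝ) →ₗ[ℝ] ℝ) (x : PiLp 1 fun _ : ι => ℝ),
      (∀ y ∈ {x : PiLp 1 fun _ : ι => ℝ | ∀ i, 0 ≤ x i}, |u y| ≤ w y ∧ w y ≤ ‖y‖) ∧
      u x = 1 ∧ w x = 0 ∧ ‖x‖ = 1 := by
  classical
  let p : ι → (PiLp 1 fun _ : ι => ℝ) →ₗ[ℝ] ℝ := fun i =>
    { toFun := fun x => x i, map_add' := fun _ _ => rfl, map_smul' := fun _ _ => rfl }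
  have hp : ∀ i x, p i x = x i := fun _ _ => rfl
  refine ⟨p i - p j, p i + p j,
    WithLp.toLp 1 fun k => if k = i then 1 / 2 else if k = j then -1 / 2 else 0, ?_, ?_, ?_, ?_⟩
  · intro y hy
    simp only [LinearMap.sub_apply, LinearMap.add_apply, hp]
    have h1 := hy i
    have h2 := hy j
    refine ⟨abs_le.mpr ⟨by linarith, by linarith⟩, ?_⟩
    rw [PiLp.norm_eq_of_L1]
    have := Finset.sum_le_sum_of_subset_of_nonneg (Finset.subset_univ {i, j})
      (f := fun k => ‖y k‖) (fun _ _ _ => norm_nonneg _)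
    rw [Finset.sum_pair hij] at this
    linarith [Real.le_norm_self (y i), Real.le_norm_self (y j)]
  · simp only [LinearMap.sub_apply, hp, if_true, if_neg hij.symm]; norm_num
  · simp only [LinearMap.add_apply, hp, if_true, if_neg hij.symm]; norm_num
  · rw [PiLp.norm_eq_of_L1, ← Finset.sum_subset (Finset.subset_univ {i, j}), Finset.sum_pair hij]
    · simp only [if_true, if_neg hij.symm]; norm_num
    · intro k _ hk
      simp only [Finset.mem_insert, Finset.mem_singleton, not_or] at hk
      simp [hk.1, hk.2]

lemma lp_funs :
    ∃ (u w : (lp (fun _ : ℕ => ℝ) 1) →ₗ[ℝ] ℝ) (x : lp (fun _ : ℕ => ℝ) 1),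
      (∀ y ∈ {x : lp (fun _ : ℕ => ℝ) 1 | ∀ i, 0 ≤ x i}, |u y| ≤ w y ∧ w y ≤ ‖y‖) ∧
      u x = 1 ∧ w x = 0 ∧ ‖x‖ = 1 := by
  let p : ℕ → (lp (fun _ : ℕ => ℝ) 1) →ₗ[ℝ] ℝ := fun i =>
    { toFun := fun x => x i, map_add' := fun _ _ => rfl, map_smul' := fun _ _ => rfl }
  have hp : ∀ i x, p i x = x i := fun _ _ => rfl
  have hz : ∀ k ∉ ({0, 1} : Finset ℕ),
      |(if k = 0 then 1 / 2 else if k = 1 then -1 / 2 else 0 : ℝ)| = 0 := by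
    intro k hk
    simp only [Finset.mem_insert, Finset.mem_singleton, not_or] at hk
    simp [hk.1, hk.2]
  refine ⟨p 0 - p 1, p 0 + p 1,
    ⟨fun k => if k = 0 then 1 / 2 else if k = 1 then -1 / 2 else 0,
      lp_mem1 _ (summable_of_ne_finset_zero hz)⟩, ?_, ?_, ?_, ?_⟩
  · intro y hy
    simp only [LinearMap.sub_apply, LinearMap.add_apply, hp]
    have h1 := hy 0
    have h2 := hy 1
    refine ⟨abs_le.mpr ⟨by linarith, by linarith⟩, ?_⟩
    rw [lp_norm1]
    have := (lp_summ y).sum_le_tsum {0, 1} (fun _ _ => abs_nonneg _)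
    rw [Finset.sum_pair (by norm_num)] at this
    linarith [le_abs_self (y 0), le_abs_self (y 1)]
  · simp only [LinearMap.sub_apply, hp]; norm_num
  · simp only [LinearMap.add_apply, hp]; norm_num
  · rw [lp_norm1, tsum_eq_sum (s := {0, 1}) (fun k hk => hz k hk), Finset.sum_pair (by norm_num)]
    norm_num [abs_div]

lemma aux_PiLp {ι : Type*} [Fintype ι] (i j : ι) (hij : i ≠ j) (n : ℕ) (hn : 1 ≤ n) :
    cssPlus (PiLp 1 fun _ : ι => ℝ) {x | ∀ i, 0 ≤ x i} n = 2 ^ (n - 1) := by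
  obtain ⟨u, w, x, h, hu, hw, hx⟩ := PiLp_funs i j hij
  exact aux_css _ n hn PiLp_cone.1 PiLp_cone.2 u w h x hu hw hx

/-- For `2 ≤ m ≤ ∞` one has `c_{ss+}(n, ℓ₁^m) = 2^{n−1}` (in particular for `ℓ₁²`), and
`2^{n−1}` equals `γ(n)`, the smallest constant `γ` with `‖x^⊗n‖_{πs+} ≤ γ·‖x‖₊ⁿ` for all
ordered normed spaces `E` and all `x ∈ E`. -/
theorem cssPlus_l1_eq_gamma (n : ℕ) (hn : 1 ≤ n) :
    (∀ m : ℕ, 2 ≤ m →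
        cssPlus (PiLp 1 fun _ : Fin m => ℝ) {x | ∀ i, 0 ≤ x i} n = 2 ^ (n - 1)) ∧
      cssPlus (lp (fun _ : ℕ => ℝ) 1) {x | ∀ i, 0 ≤ x i} n = 2 ^ (n - 1) ∧
      cssPlus (PiLp 1 fun _ : Fin 2 => ℝ) {x | ∀ i, 0 ≤ x i} n = 2 ^ (n - 1) ∧
      (∀ (E : Type*) [NormedAddCommGroup E] [NormedSpace ℝ E] (P : Set E),
        IsGenCone P → CPlusFinite P →
        ∀ x : E,
          symProjNormPos P n (⨂ₜ[ℝ] (_ : Fin n), x) ≤ 2 ^ (n - 1) * normPlus P x ^ n) ∧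
      ∀ γ : ℝ,
        (∀ (E : Type*) [NormedAddCommGroup E] [NormedSpace ℝ E] (P : Set E),
          IsGenCone P → CPlusFinite P →
          ∀ x : E,
            symProjNormPos P n (⨂ₜ[ℝ] (_ : Fin n), x) ≤ γ * normPlus P x ^ n) →
        (2 : ℝ) ^ (n - 1) ≤ γ := by
  refine ⟨fun m hm => aux_PiLp (⟨0, by omega⟩ : Fin m) ⟨1, by omega⟩ (by simp) n hn, ?_,
    aux_PiLp (0 : Fin 2) 1 (by simp) n hn, fun E _ _ P hP _ x => aux_upper P n hn hP x, ?_⟩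
  · obtain ⟨u, w, x, h, hu, hw, hx⟩ := lp_funs
    exact aux_css _ n hn lp_cone.1 lp_cone.2 u w h x hu hw hx
  · intro γ hγ
    obtain ⟨u, w, x, h, hu, hw, hx⟩ :=
      PiLp_funs (ULift.up 0 : ULift (Fin 2)) (ULift.up 1) (by simp)
    have hc := PiLp_cone (ι := ULift (Fin 2))
    have h1 := hγ (PiLp 1 fun _ : ULift (Fin 2) => ℝ) _ hc.1 (by
      refine ⟨1, ?_⟩
      rintro r ⟨y, hy, rfl⟩
      exact (normPlus_le_of _ y (hc.2 y)).trans hy) x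
    have h2 := aux_lower _ n hn hc.1 u w h x hu hw
    have h3 := normPlus_le_of _ x (hc.2 x)
    rw [hx] at h3
    have h4 := normPlus_nonneg {x : PiLp 1 fun _ : ULift (Fin 2) => ℝ | ∀ i, 0 ≤ x i} x
    have h5 := pow_le_one₀ (n := n) h4 h3
    have h6 := pow_nonneg h4 n
    have h7 : (0 : ℝ) < 2 ^ (n - 1) := by positivity
    have h8 := h2.trans h1
    by_cases h0 : 0 ≤ γ
    · nlinarith
    · nlinarith

end
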